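/- arXiv:1803.11011 — 2 statements merged into one kernel-verified Lean document; each statement's English description precedes it below -/
import Mathlib

section
/- If ψ ∈ L²(ℝ^{3N}) is symmetric in all variables in M₁₂ ⊇ {1,2}, then ‖f̂ q_1 q_2 ψ‖² ≤ N²/(|M₁₂|(|M₁₂|-1)) · ‖f̂ n̂² ψ‖². -/
/- STATEMENT 8: If `ψ` is symmetric in all variables in `M₁₂ ⊇ {1,2}`, then
`‖f̂ q₁ q₂ ψ‖² ≤ N²/(|M₁₂|(|M₁₂|−1)) ‖f̂ n̂² ψ‖²`, where `n̂²` is the weighted operator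
with weight `k/N`. -/

noncomputable section

open scoped ComplexInnerProductSpace

def symP {E : Type*} [NormedAddCommGroup E] [InnerProductSpace ℂ E]
    (N : ℕ) (p q : Fin N → E →L[ℂ] E) (k : ℕ) : E →L[ℂ] E :=
  ∑ J ∈ Finset.powersetCard k (Finset.univ : Finset (Fin N)),
    ((List.finRange N).map (fun j => if j ∈ J then q j else p j)).prod

def hatW {E : Type*} [NormedAddCommGroup E] [InnerProductSpace ℂ E]
    (N : ℕ) (P : ℕ → E →L[ℂ] E) (f : ℕ → ℝ) : E →L[ℂ] E :=
  ∑ k ∈ Finset.range (N + 1), (f k : ℂ) • P k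

/-- In a commutative algebra, the operators `Pₖ` weighted by `k` sum up to `∑ⱼ qⱼ`. -/
theorem sum_smul_powersetCard_eq {R : Type*} [CommRing R] [Algebra ℂ R] (N : ℕ) (p : Fin N → R)
    (hp : ∀ j, IsIdempotentElem (p j)) :
    ∑ k ∈ Finset.range (N + 1), (k : ℂ) •
      ∑ J ∈ Finset.powersetCard k (Finset.univ : Finset (Fin N)),
        ∏ j, (if j ∈ J then 1 - p j else p j) = ∑ j, (1 - p j) := by
  have hone : ∑ J : Finset (Fin N), ∏ j, (if j ∈ J then 1 - p j else p j) = 1 := by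
    have h := Finset.prod_add (fun j => 1 - p j) p (Finset.univ : Finset (Fin N))
    simp only [sub_add_cancel, Finset.prod_const_one, Finset.powerset_univ] at h
    refine Eq.trans (Finset.sum_congr rfl fun J _ => ?_) h.symm
    rw [Finset.prod_ite]
    congr 2 <;> · ext; simp
  have hmul (i : Fin N) (J : Finset (Fin N)) :
      (1 - p i) * ∏ j, (if j ∈ J then 1 - p j else p j) =
        if i ∈ J then ∏ j, (if j ∈ J then 1 - p j else p j) else 0 := by
    rw [← Finset.mul_prod_erase _ _ (Finset.mem_univ i), ← mul_assoc]
    split_ifs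
    · rw [(hp i).one_sub.eq]
    · rw [sub_mul, one_mul, (hp i).eq, sub_self, zero_mul]
  have hsum : ∑ j, (1 - p j) =
      ∑ J : Finset (Fin N), (J.card : ℂ) • ∏ j, (if j ∈ J then 1 - p j else p j) := by
    trans (∑ j, (1 - p j)) * ∑ J : Finset (Fin N), ∏ j, (if j ∈ J then 1 - p j else p j)
    · rw [hone, mul_one]
    rw [Finset.mul_sum]
    refine Finset.sum_congr rfl fun J _ => ?_
    rw [Finset.sum_mul, Finset.sum_congr rfl fun i _ => hmul i J, Finset.sum_ite_mem,
      Finset.univ_inter, Finset.sum_const, Nat.cast_smul_eq_nsmul]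
  rw [hsum, ← Finset.powerset_univ, Finset.sum_powerset]
  simp only [Finset.card_univ, Fintype.card_fin]
  refine Finset.sum_congr rfl fun k _ => ?_
  rw [Finset.smul_sum]
  refine Finset.sum_congr rfl fun J hJ => ?_
  rw [(Finset.mem_powersetCard.1 hJ).2]

section

variable {E : Type*} [NormedAddCommGroup E] [InnerProductSpace ℂ E] {N : ℕ}
  {p q : Fin N → E →L[ℂ] E}

open scoped IsMulCommutative in
/-- The operator with weight `k / N` is the average of the projections `qⱼ`. -/
theorem hatW_symP_div_eq (hidem : ∀ j, IsIdempotentElem (p j))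
    (hcomm : ∀ i j, Commute (p i) (p j)) (hq : ∀ j, q j = 1 - p j) :
    hatW N (symP N p q) (fun k => (k : ℝ) / N) = (N : ℂ)⁻¹ • ∑ j, q j := by
  let A := Algebra.adjoin ℂ (Set.range p)
  have : IsMulCommutative A := Algebra.isMulCommutative_adjoin ℂ (by
    rintro _ ⟨i, rfl⟩ _ ⟨j, rfl⟩
    exact hcomm i j)
  let p' : Fin N → A := fun j => ⟨p j, Algebra.subset_adjoin ⟨j, rfl⟩⟩
  have hp' (j : Fin N) : A.val (p' j) = p j := rfl
  have h := congrArg A.val (sum_smul_powersetCard_eq N p' fun j => Subtype.ext (hidem j).eq)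
  have hprod (J : Finset (Fin N)) : A.val (∏ j, (if j ∈ J then 1 - p' j else p' j)) =
      ((List.finRange N).map (fun j => if j ∈ J then q j else p j)).prod := by
    rw [Fin.prod_univ_def, map_list_prod, List.map_map]
    congr 1
    refine List.map_congr_left fun j _ => ?_
    simp only [Function.comp_apply, hq]
    split_ifs <;> simp only [map_sub, map_one, hp']
  simp only [map_sum, map_smul, hprod, map_sub, map_one, hp', ← hq] at h
  rw [← h, Finset.smul_sum, hatW]
  refine Finset.sum_congr rfl fun k _ => ?_
  rw [smul_smul, symP]
  congr 1
  push_cast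
  ring

theorem commute_hatW_symP {B : E →L[ℂ] E} (hp : ∀ j, Commute B (p j))
    (hq : ∀ j, Commute B (q j)) (f : ℕ → ℝ) : Commute B (hatW N (symP N p q) f) := by
  refine Commute.sum_right _ _ _ fun k _ => Commute.smul_right ?_ _
  refine Commute.sum_right _ _ _ fun J _ => Commute.list_prod_right _ _ fun x hx => ?_
  obtain ⟨j, -, rfl⟩ := List.mem_map.1 hx
  split_ifs
  exacts [hq j, hp j]

theorem semiconjBy_list_prod {ι M : Type*} [Monoid M] {u : M} {g g' : ι → M} (l : List ι)
    (h : ∀ i, SemiconjBy u (g i) (g' i)) : SemiconjBy u (l.map g).prod (l.map g').prod := by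
  induction l with
  | nil => exact SemiconjBy.one_right u
  | cons a l ih => simpa using (h a).mul_right ih

/-- An operator permuting the one-particle projections commutes with weighted operators. -/
theorem commute_hatW_symP_of_perm {u : E →L[ℂ] E} {σ : Equiv.Perm (Fin N)}
    (hpp : ∀ i j, Commute (p i) (p j)) (hpq : ∀ i j, Commute (p i) (q j))
    (hqq : ∀ i j, Commute (q i) (q j))
    (hp : ∀ j, SemiconjBy u (p j) (p (σ j))) (hq : ∀ j, SemiconjBy u (q j) (q (σ j)))
    (f : ℕ → ℝ) : Commute u (hatW N (symP N p q) f) := by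
  have hprod (J : Finset (Fin N)) :
      SemiconjBy u ((List.finRange N).map (fun j => if j ∈ J then q j else p j)).prod
        ((List.finRange N).map
          (fun j => if j ∈ J.map σ.toEmbedding then q j else p j)).prod := by
    have hperm : ((List.finRange N).map σ).Perm (List.finRange N) :=
      Equiv.Perm.map_finRange_perm σ
    rw [← (hperm.map fun j => if j ∈ J.map σ.toEmbedding then q j else p j).prod_eq',
      List.map_map]
    · refine semiconjBy_list_prod _ fun j => ?_
      simp only [Function.comp_apply, Finset.mem_map_equiv, Equiv.symm_apply_apply]
      split_ifs
      exacts [hq j, hp j]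
    · refine List.pairwise_of_forall_mem_list fun x hx y hy => ?_
      obtain ⟨i, -, rfl⟩ := List.mem_map.1 hx
      obtain ⟨j, -, rfl⟩ := List.mem_map.1 hy
      split_ifs
      exacts [hqq _ _, (hpq _ _).symm, hpq _ _, hpp _ _]
  refine Commute.sum_right _ _ _ fun k _ => Commute.smul_right ?_ _
  rw [commute_iff_eq, symP, Finset.mul_sum, Finset.sum_mul]
  refine Finset.sum_equiv σ.finsetCongr (fun J => ?_) (fun J _ => (hprod J).eq)
  simp [Finset.mem_powersetCard]

end

theorem norm_sq_sum_apply_eq {E ι : Type*} [NormedAddCommGroup E] [InnerProductSpace ℂ E]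
    [CompleteSpace E] [Fintype ι] {q : ι → E →L[ℂ] E} (hidem : ∀ j, IsIdempotentElem (q j))
    (hsa : ∀ j, IsSelfAdjoint (q j)) (hcomm : ∀ i j, Commute (q i) (q j)) (x : E) :
    ‖∑ j, q j x‖ ^ 2 = ∑ i, ∑ j, ‖q i (q j x)‖ ^ 2 := by
  have hsymm (j : ι) (y z : E) : ⟪q j y, z⟫ = ⟪y, q j z⟫ :=
    ContinuousLinearMap.isSelfAdjoint_iff_isSymmetric.1 (hsa j) y z
  have hsq (j : ι) (y : E) : q j (q j y) = q j y := congrArg (· y) (hidem j).eq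
  have hc (i j : ι) (y : E) : q i (q j y) = q j (q i y) := congrArg (· y) (hcomm i j).eq
  have hnorm (y : E) : ((‖y‖ ^ 2 : ℝ) : ℂ) = ⟪y, y⟫ := by
    rw [inner_self_eq_norm_sq_to_K]
    simp
  have key (i j : ι) : ⟪q j x, q i x⟫ = ((‖q i (q j x)‖ ^ 2 : ℝ) : ℂ) := by
    rw [hnorm, hsymm i, hsq i, hc i j, ← hsymm j, hsq j]
  apply Complex.ofReal_injective
  rw [hnorm, inner_sum]
  simp only [sum_inner, key, Complex.ofReal_sum]

/-- A permutation supported in `s` can move two given points of `s` to any other two. -/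
theorem exists_perm_apply_eq_apply_eq {α : Type*} [DecidableEq α] {s : Finset α} {a b i j : α}
    (ha : a ∈ s) (hb : b ∈ s) (hi : i ∈ s) (hj : j ∈ s) (hab : a ≠ b) (hij : i ≠ j) :
    ∃ σ : Equiv.Perm α, (∀ x ∉ s, σ x = x) ∧ σ a = i ∧ σ b = j := by
  refine ⟨Equiv.swap (Equiv.swap a i b) j * Equiv.swap a i, fun x hx => ?_, ?_, ?_⟩
  · have hs : Equiv.swap a i b ∈ s := by
      rw [Equiv.swap_apply_def]
      split_ifs <;> assumption
    have hne {y : α} (hy : y ∈ s) : x ≠ y := fun h => hx (h ▸ hy)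
    rw [Equiv.Perm.mul_apply, Equiv.swap_apply_of_ne_of_ne (hne ha) (hne hi),
      Equiv.swap_apply_of_ne_of_ne (hne hs) (hne hj)]
  · rw [Equiv.Perm.mul_apply, Equiv.swap_apply_left, Equiv.swap_apply_of_ne_of_ne _ hij]
    rw [← Equiv.swap_apply_left a i]
    exact fun h => hab ((Equiv.swap a i).injective (by simpa using h))
  · rw [Equiv.Perm.mul_apply, Equiv.swap_apply_left]

theorem stmt8 {E : Type*} [NormedAddCommGroup E] [InnerProductSpace ℂ E] [CompleteSpace E]
    (N : ℕ) (hN : 1 < N) (p q : Fin N → E →L[ℂ] E)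
    (hidem : ∀ j, IsIdempotentElem (p j))
    (hsa : ∀ j, IsSelfAdjoint (p j))
    (hcomm : ∀ i j, Commute (p i) (p j))
    (hq : ∀ j, q j = 1 - p j)
    (U : Equiv.Perm (Fin N) → E →L[ℂ] E)
    (hU1 : U 1 = 1)
    (hUmul : ∀ σ τ, U (σ * τ) = U σ * U τ)
    (hUinner : ∀ σ (x y : E), ⟪U σ x, U σ y⟫ = ⟪x, y⟫)
    (hUp : ∀ σ j, U σ * p j = p (σ j) * U σ)
    (M₁₂ : Finset (Fin N))
    (hM1 : (⟨0, Nat.lt_of_lt_of_le Nat.one_pos hN.le⟩ : Fin N) ∈ M₁₂)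
    (hM2 : (⟨1, hN⟩ : Fin N) ∈ M₁₂)
    (f : ℕ → ℝ) (hf : ∀ k, 0 ≤ f k)
    (ψ : E)
    (hψ : ∀ σ : Equiv.Perm (Fin N), (∀ i ∉ M₁₂, σ i = i) → U σ ψ = ψ) :
    ‖(hatW N (symP N p q) f)
        ((q ⟨0, Nat.lt_of_lt_of_le Nat.one_pos hN.le⟩) ((q ⟨1, hN⟩) ψ))‖ ^ 2 ≤
      ((N : ℝ) ^ 2 / (M₁₂.card * ((M₁₂.card : ℝ) - 1))) *
        ‖(hatW N (symP N p q) f)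
          ((hatW N (symP N p q) (fun k => (k : ℝ) / N)) ψ)‖ ^ 2 := by
  have hpq (i j : Fin N) : Commute (p i) (q j) := by
    rw [hq j]
    exact (Commute.one_right _).sub_right (hcomm i j)
  have hqq (i j : Fin N) : Commute (q i) (q j) := by
    rw [hq i]
    exact (Commute.one_left _).sub_left (hpq i j)
  have hqidem (j : Fin N) : IsIdempotentElem (q j) := hq j ▸ (hidem j).one_sub
  have hqsa (j : Fin N) : IsSelfAdjoint (q j) := hq j ▸ (IsSelfAdjoint.one _).sub (hsa j)
  have hUq (σ : Equiv.Perm (Fin N)) (j : Fin N) : U σ * q j = q (σ j) * U σ := by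
    rw [hq, hq, mul_sub, sub_mul, hUp, mul_one, one_mul]
  set a : Fin N := ⟨0, Nat.lt_of_lt_of_le Nat.one_pos hN.le⟩
  set b : Fin N := ⟨1, hN⟩
  have hab : a ≠ b := by simp [a, b]
  set A := hatW N (symP N p q) f
  have hqA (j : Fin N) (x : E) : A (q j x) = q j (A x) :=
    congrArg (· x) (commute_hatW_symP (fun i => (hpq i j).symm) (hqq j) f).eq.symm
  have hUA (σ : Equiv.Perm (Fin N)) (x : E) : U σ (A x) = A (U σ x) :=
    congrArg (· x) (commute_hatW_symP_of_perm hcomm hpq hqq (hUp σ) (hUq σ) f).eq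
  have hUnorm (σ : Equiv.Perm (Fin N)) (x : E) : ‖U σ x‖ = ‖x‖ := by
    rw [@norm_eq_sqrt_re_inner ℂ, @norm_eq_sqrt_re_inner ℂ, hUinner]
  have hconst : ∀ x ∈ M₁₂.offDiag, ‖q x.1 (q x.2 (A ψ))‖ ^ 2 = ‖q a (q b (A ψ))‖ ^ 2 := by
    intro x hx
    obtain ⟨hi, hj, hij⟩ := Finset.mem_offDiag.1 hx
    obtain ⟨σ, hσ, hσa, hσb⟩ := exists_perm_apply_eq_apply_eq hM1 hM2 hi hj hab hij
    have hUq' (j : Fin N) (y : E) : q (σ j) (U σ y) = U σ (q j y) :=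
      congrArg (· y) (hUq σ j).symm
    rw [← hσa, ← hσb, ← hψ σ hσ, ← hUA, hUq', hUq', hUnorm, hUA, hψ σ hσ]
  have hle : ((M₁₂.card : ℝ) * (M₁₂.card - 1)) * ‖q a (q b (A ψ))‖ ^ 2 ≤
      ‖∑ j, q j (A ψ)‖ ^ 2 := by
    calc ((M₁₂.card : ℝ) * (M₁₂.card - 1)) * ‖q a (q b (A ψ))‖ ^ 2
        = ∑ x ∈ M₁₂.offDiag, ‖q x.1 (q x.2 (A ψ))‖ ^ 2 := by
          rw [Finset.sum_congr rfl hconst, Finset.sum_const, Finset.offDiag_card, nsmul_eq_mul,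
            Nat.cast_sub (Nat.le_mul_self _), Nat.cast_mul]
          ring
      _ ≤ ∑ x : Fin N × Fin N, ‖q x.1 (q x.2 (A ψ))‖ ^ 2 :=
          Finset.sum_le_sum_of_subset_of_nonneg (Finset.subset_univ _)
            fun _ _ _ => sq_nonneg _
      _ = ‖∑ j, q j (A ψ)‖ ^ 2 := by
          rw [norm_sq_sum_apply_eq hqidem hqsa hqq, Fintype.sum_prod_type]
  have hcard : (1 : ℝ) < M₁₂.card := by
    exact_mod_cast Finset.one_lt_card.2 ⟨a, hM1, b, hM2, hab⟩
  have hNpos : (0 : ℝ) < N := by exact_mod_cast hN.le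
  have hright : ‖A (hatW N (symP N p q) (fun k => (k : ℝ) / N) ψ)‖ ^ 2 =
      ((N : ℝ) ^ 2)⁻¹ * ‖∑ j, q j (A ψ)‖ ^ 2 := by
    rw [hatW_symP_div_eq hidem hcomm hq, smul_apply, map_smul,
      sum_apply, map_sum]
    simp only [hqA]
    rw [norm_smul, mul_pow, norm_inv, Complex.norm_natCast, inv_pow]
  rw [hqA, hqA, hright, div_mul_eq_mul_div, mul_inv_cancel_left₀ (by positivity),
    le_div_iff₀ (mul_pos (by linarith) (by linarith)), mul_comm]
  exact hle

end
end

section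
/- With h as above and assuming additionally ‖w‖_{L^∞} ≤ C₁ μ^{-3} ∫ w and ∫_{ℝ³} w ≤ C₂ A (for constants C₁, C₂ and A > 0), the gradient satisfies ‖∇h‖_{L^∞(ℝ³)} ≲ A μ^{-2} and ‖∇h‖_{L²(ℝ³)} ≲ A μ^{-1/2}, with implicit constants depending only on C₁, C₂ and requiring ε/μ > 2. -/
/- STATEMENT 17: With `h` the Dirichlet solution of `Δh = w` on `B_ε(0)` (extended by 0)
as in Statement 16, and assuming `‖w‖_∞ ≤ C₁ μ⁻³ ∫w` and `∫ w ≤ C₂ A`, the gradient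
satisfies `‖∇h‖_∞ ≲ A μ⁻²` and `‖∇h‖_{L²} ≲ A μ^{-1/2}`, with implicit constants
depending only on `C₁, C₂` and requiring `ε/μ > 2`. -/

open MeasureTheory

/-- The profile of `‖y‖⁻²` truncated to the unit ball. -/
noncomputable def truncInvSq : ℝ → ℝ := Set.indicator (Set.Iio 1) fun r => (r ^ 2)⁻¹

lemma truncInvSq_nonneg (r : ℝ) : 0 ≤ truncInvSq r :=
  Set.indicator_nonneg (fun _ _ => by positivity) r

lemma integrable_truncInvSq_norm :
    Integrable fun y : EuclideanSpace ℝ (Fin 3) => truncInvSq ‖y‖ := by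
  rw [integrable_fun_norm_addHaar (volume : Measure (EuclideanSpace ℝ (Fin 3)))]
  have h : IntegrableOn (Set.indicator (Set.Ioo (0 : ℝ) 1) fun _ => (1 : ℝ)) (Set.Ioi 0) := by
    apply Integrable.integrableOn
    rw [integrable_indicator_iff measurableSet_Ioo]
    simp
  refine h.congr_fun (fun r hr => ?_) measurableSet_Ioi
  have hr0 : (0 : ℝ) < r := hr
  by_cases h1 : r < 1 <;> simp [truncInvSq, h1, hr0, hr0.ne']

lemma integrable_scaled_truncInvSq {μ : ℝ} (hμ : 0 < μ) (z : EuclideanSpace ℝ (Fin 3)) :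
    Integrable fun ζ : EuclideanSpace ℝ (Fin 3) => truncInvSq ‖μ⁻¹ • (z - ζ)‖ :=
  (integrable_truncInvSq_norm.comp_smul (inv_ne_zero hμ.ne')).comp_sub_left z

lemma integral_scaled_truncInvSq {μ : ℝ} (hμ : 0 < μ) (z : EuclideanSpace ℝ (Fin 3)) :
    (∫ ζ : EuclideanSpace ℝ (Fin 3), truncInvSq ‖μ⁻¹ • (z - ζ)‖) =
      μ ^ 3 * ∫ y : EuclideanSpace ℝ (Fin 3), truncInvSq ‖y‖ := by
  rw [integral_sub_left_eq_self
    (fun y : EuclideanSpace ℝ (Fin 3) => truncInvSq ‖μ⁻¹ • y‖) volume z,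
    Measure.integral_comp_inv_smul_of_nonneg volume
      (fun y : EuclideanSpace ℝ (Fin 3) => truncInvSq ‖y‖) hμ.le]
  simp

/-- A bounded integrable density is integrable against `‖z - ·‖⁻²` in dimension three. -/
lemma integrable_mul_inv_sq {w : EuclideanSpace ℝ (Fin 3) → ℝ} {μ B : ℝ} (hμ : 0 < μ)
    (hw0 : ∀ z, 0 ≤ w z) (hwB : ∀ z, w z ≤ B) (hw : Integrable w)
    (z : EuclideanSpace ℝ (Fin 3)) :
    Integrable (fun ζ => w ζ * (‖z - ζ‖ ^ 2)⁻¹) ∧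
      (∫ ζ, w ζ * (‖z - ζ‖ ^ 2)⁻¹) ≤ (∫ ζ, w ζ) * (μ ^ 2)⁻¹ +
        B * μ * ∫ y : EuclideanSpace ℝ (Fin 3), truncInvSq ‖y‖ := by
  have hpt : ∀ ζ, w ζ * (‖z - ζ‖ ^ 2)⁻¹ ≤
      w ζ * (μ ^ 2)⁻¹ + B * (μ ^ 2)⁻¹ * truncInvSq ‖μ⁻¹ • (z - ζ)‖ := by
    intro ζ
    have hB : 0 ≤ B := (hw0 ζ).trans (hwB ζ)
    by_cases h : ‖z - ζ‖ < μ
    · have h1 : ‖μ⁻¹ • (z - ζ)‖ < 1 := by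
        rw [norm_smul, Real.norm_of_nonneg (by positivity), inv_mul_lt_iff₀ hμ]
        simpa using h
      have h2 : truncInvSq ‖μ⁻¹ • (z - ζ)‖ = μ ^ 2 * (‖z - ζ‖ ^ 2)⁻¹ := by
        rw [truncInvSq, Set.indicator_of_mem (by exact h1), norm_smul,
          Real.norm_of_nonneg (by positivity)]
        rw [mul_pow, mul_inv, inv_pow, inv_inv]
      rw [h2]
      have h3 : B * (μ ^ 2)⁻¹ * (μ ^ 2 * (‖z - ζ‖ ^ 2)⁻¹) = B * (‖z - ζ‖ ^ 2)⁻¹ := by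
        field_simp
      rw [h3]
      have h4 : w ζ * (‖z - ζ‖ ^ 2)⁻¹ ≤ B * (‖z - ζ‖ ^ 2)⁻¹ :=
        mul_le_mul_of_nonneg_right (hwB ζ) (by positivity)
      have h5 : 0 ≤ w ζ * (μ ^ 2)⁻¹ := mul_nonneg (hw0 ζ) (by positivity)
      linarith
    · have h4 : w ζ * (‖z - ζ‖ ^ 2)⁻¹ ≤ w ζ * (μ ^ 2)⁻¹ := by
        refine mul_le_mul_of_nonneg_left ?_ (hw0 ζ)
        have := not_lt.mp h
        gcongr
      have h5 : 0 ≤ B * (μ ^ 2)⁻¹ * truncInvSq ‖μ⁻¹ • (z - ζ)‖ :=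
        mul_nonneg (by positivity) (truncInvSq_nonneg _)
      linarith
  have hI1 : Integrable fun ζ => w ζ * (μ ^ 2)⁻¹ := hw.mul_const _
  have hI2 : Integrable fun ζ => B * (μ ^ 2)⁻¹ * truncInvSq ‖μ⁻¹ • (z - ζ)‖ :=
    (integrable_scaled_truncInvSq hμ z).const_mul _
  have hI : Integrable (fun ζ => w ζ * (‖z - ζ‖ ^ 2)⁻¹) := by
    refine (hI1.add hI2).mono' ?_ (Filter.Eventually.of_forall fun ζ => ?_)
    · exact hw.aestronglyMeasurable.mul (by fun_prop : Measurable _).aestronglyMeasurable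
    · rw [Real.norm_of_nonneg (mul_nonneg (hw0 ζ) (by positivity))]
      exact hpt ζ
  refine ⟨hI, (integral_mono hI (hI1.add hI2) hpt).trans_eq ?_⟩
  simp only [Pi.add_apply]
  rw [integral_add hI1 hI2, integral_mul_const, integral_const_mul,
    integral_scaled_truncInvSq hμ z]
  field_simp

lemma add_norm_sq_integral {μ : ℝ} (hμ : 0 < μ) :
    Integrable (fun z : EuclideanSpace ℝ (Fin 3) => ((μ + ‖z‖) ^ 4)⁻¹) ∧
      (∫ z : EuclideanSpace ℝ (Fin 3), ((μ + ‖z‖) ^ 4)⁻¹) =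
        μ⁻¹ * ∫ z : EuclideanSpace ℝ (Fin 3), ((1 + ‖z‖) ^ 4)⁻¹ := by
  have h0 : Integrable (fun z : EuclideanSpace ℝ (Fin 3) => ((1 + ‖z‖) ^ 4)⁻¹) := by
    have h := integrable_one_add_norm (E := EuclideanSpace ℝ (Fin 3)) (μ := volume) (r := 4)
      (by simp; norm_num)
    refine h.congr (Filter.Eventually.of_forall fun z => ?_)
    have : (0 : ℝ) ≤ 1 + ‖z‖ := by positivity
    simp only [Real.rpow_neg this]
    norm_cast
  have he : (fun z : EuclideanSpace ℝ (Fin 3) => ((μ + ‖z‖) ^ 4)⁻¹) =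
      fun z => (μ ^ 4)⁻¹ * ((1 + ‖μ⁻¹ • z‖) ^ 4)⁻¹ := by
    ext z
    rw [norm_smul, Real.norm_of_nonneg (by positivity), ← mul_inv, ← mul_pow]
    congr 2
    field_simp
  rw [he]
  refine ⟨(h0.comp_smul (inv_ne_zero hμ.ne')).const_mul _, ?_⟩
  rw [integral_const_mul, Measure.integral_comp_inv_smul_of_nonneg volume
      (fun y : EuclideanSpace ℝ (Fin 3) => ((1 + ‖y‖) ^ 4)⁻¹) hμ.le]
  simp
  field_simp

lemma abs_inv_norm_sub_inv_norm_le {E : Type*} [NormedAddCommGroup E] (a b : E) :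
    |‖a‖⁻¹ - ‖b‖⁻¹| ≤ ‖a - b‖ * ((‖a‖ ^ 2)⁻¹ + (‖b‖ ^ 2)⁻¹) := by
  rcases eq_or_ne a 0 with rfl | ha
  · rcases eq_or_ne b 0 with rfl | hb
    · simp
    · have : ‖b‖ ≠ 0 := norm_ne_zero_iff.mpr hb
      simp only [norm_zero, inv_zero, zero_sub, norm_neg, abs_neg]
      rw [abs_of_nonneg (by positivity)]
      apply le_of_eq
      field_simp
      simp
  rcases eq_or_ne b 0 with rfl | hb
  · have : ‖a‖ ≠ 0 := norm_ne_zero_iff.mpr ha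
    simp only [norm_zero, inv_zero, sub_zero]
    rw [abs_of_nonneg (by positivity)]
    apply le_of_eq
    field_simp
    simp
  have ha' : 0 < ‖a‖ := norm_pos_iff.mpr ha
  have hb' : 0 < ‖b‖ := norm_pos_iff.mpr hb
  have h1 : ‖a‖⁻¹ - ‖b‖⁻¹ = (‖b‖ - ‖a‖) * (‖a‖⁻¹ * ‖b‖⁻¹) := by field_simp
  rw [h1, abs_mul, abs_of_nonneg (by positivity : 0 ≤ ‖a‖⁻¹ * ‖b‖⁻¹)]
  refine mul_le_mul ?_ ?_ (by positivity) (by positivity)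
  · rw [abs_sub_comm]
    exact abs_norm_sub_norm_le a b
  · rw [← inv_pow, ← inv_pow]
    nlinarith [sq_nonneg (‖a‖⁻¹ - ‖b‖⁻¹), sq_nonneg ‖a‖⁻¹, sq_nonneg ‖b‖⁻¹]

/-- A function vanishing outside an open ball has zero derivative there. -/
lemma fderiv_eq_zero_of_ball_le_norm {E : Type*} [NormedAddCommGroup E] [InnerProductSpace ℝ E]
    {h : E → ℝ} {ε : ℝ} (hh : ∀ z, ε ≤ ‖z‖ → h z = 0) {z : E} (hz : ε ≤ ‖z‖) :
    fderiv ℝ h z = 0 := by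
  by_cases hd : DifferentiableAt ℝ h z
  swap
  · exact fderiv_zero_of_not_differentiableAt hd
  have key : ∀ v : E, 0 ≤ inner ℝ z v → fderiv ℝ h z v = 0 := by
    intro v hv
    have hl := (hd.hasFDerivAt.hasLineDerivAt v).tendsto_slope_zero_right
    have h0 : Filter.Tendsto (fun t : ℝ => t⁻¹ • (h (z + t • v) - h z))
        (nhdsWithin 0 (Set.Ioi 0)) (nhds 0) := by
      refine tendsto_const_nhds.congr' ?_
      filter_upwards [self_mem_nhdsWithin] with t ht
      have ht0 : (0 : ℝ) < t := ht
      have h1 : ε ≤ ‖z + t • v‖ := by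
        refine hz.trans (le_of_sq_le_sq ?_ (norm_nonneg _))
        rw [norm_add_sq_real, inner_smul_right]
        have := mul_nonneg ht0.le hv
        nlinarith [sq_nonneg ‖t • v‖]
      simp [hh _ h1, hh _ hz]
    exact tendsto_nhds_unique hl h0
  ext v
  rcases le_total 0 (inner ℝ z v) with hv | hv
  · simpa using key v hv
  · have := key (-v) (by rw [inner_neg_right]; linarith)
    simpa using this

/-- Decay of the convolution of a density supported in `‖ζ‖ ≤ μ` with `‖·‖⁻²`. -/
lemma integral_mul_inv_sq_le {w : EuclideanSpace ℝ (Fin 3) → ℝ} {μ C₁ : ℝ} (hμ : 0 < μ)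
    (hC₁ : 0 < C₁) (hw0 : ∀ z, 0 ≤ w z) (hws : ∀ z, μ < ‖z‖ → w z = 0)
    (hwB : ∀ z, w z ≤ C₁ * (∫ ζ, w ζ) / μ ^ 3) (hw : Integrable w)
    (z : EuclideanSpace ℝ (Fin 3)) :
    (∫ ζ, w ζ * (‖z - ζ‖ ^ 2)⁻¹) ≤
      9 * (1 + C₁ * ∫ y : EuclideanSpace ℝ (Fin 3), truncInvSq ‖y‖) * (∫ ζ, w ζ) *
        ((μ + ‖z‖) ^ 2)⁻¹ := by
  obtain ⟨hI, hle⟩ := integrable_mul_inv_sq hμ hw0 hwB hw z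
  set M := ∫ ζ, w ζ with hM
  set J := ∫ y : EuclideanSpace ℝ (Fin 3), truncInvSq ‖y‖ with hJ
  have hM0 : 0 ≤ M := integral_nonneg hw0
  have hJ0 : 0 ≤ J := integral_nonneg fun y => truncInvSq_nonneg _
  have hz0 := norm_nonneg z
  rcases le_or_gt ‖z‖ (2 * μ) with h | h
  · have h1 : (μ ^ 2)⁻¹ ≤ 9 * ((μ + ‖z‖) ^ 2)⁻¹ := by
      rw [← div_eq_mul_inv, le_div_iff₀ (by positivity), inv_mul_le_iff₀ (by positivity)]
      nlinarith
    calc _ ≤ M * (μ ^ 2)⁻¹ + C₁ * M / μ ^ 3 * μ * J := hle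
      _ = (1 + C₁ * J) * M * (μ ^ 2)⁻¹ := by field_simp
      _ ≤ (1 + C₁ * J) * M * (9 * ((μ + ‖z‖) ^ 2)⁻¹) := by gcongr
      _ = _ := by ring
  · have hpt : ∀ ζ, w ζ * (‖z - ζ‖ ^ 2)⁻¹ ≤ w ζ * (9 * ((μ + ‖z‖) ^ 2)⁻¹) := by
      intro ζ
      rcases lt_or_ge μ ‖ζ‖ with hζ | hζ
      · simp [hws ζ hζ]
      refine mul_le_mul_of_nonneg_left ?_ (hw0 ζ)
      have h2 : ‖z‖ - ‖ζ‖ ≤ ‖z - ζ‖ := norm_sub_norm_le z ζ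
      have h3 : 0 < ‖z - ζ‖ := by linarith
      rw [← div_eq_mul_inv, le_div_iff₀ (by positivity), inv_mul_le_iff₀ (by positivity)]
      nlinarith
    calc _ ≤ ∫ ζ, w ζ * (9 * ((μ + ‖z‖) ^ 2)⁻¹) := integral_mono hI (hw.mul_const _) hpt
      _ = 9 * 1 * M * ((μ + ‖z‖) ^ 2)⁻¹ := by rw [integral_mul_const]; ring
      _ ≤ _ := by
        have : 0 ≤ C₁ * J := by positivity
        gcongr
        linarith

lemma abs_integral_sub_integral_le {α : Type*} [MeasurableSpace α] {ν : Measure α}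
    {f g b : α → ℝ} (hf : Integrable f ν) (hg : Integrable g ν) (hb : Integrable b ν)
    (h : ∀ a, |f a - g a| ≤ b a) : |(∫ a, f a ∂ν) - ∫ a, g a ∂ν| ≤ ∫ a, b a ∂ν := by
  rw [← integral_sub hf hg]
  exact norm_integral_le_of_norm_le (f := fun a => f a - g a) hb (Filter.Eventually.of_forall h)

/-- Increment bound for the Newton potential. -/
lemma abs_newton_sub_le {w : EuclideanSpace ℝ (Fin 3) → ℝ} {μ B : ℝ} (hμ : 0 < μ)
    (hw0 : ∀ z, 0 ≤ w z) (hwB : ∀ z, w z ≤ B) (hw : Integrable w)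
    (x z : EuclideanSpace ℝ (Fin 3)) :
    |(∫ ζ, w ζ / ‖x - ζ‖) - ∫ ζ, w ζ / ‖z - ζ‖| ≤
      ‖x - z‖ * ((∫ ζ, w ζ * (‖x - ζ‖ ^ 2)⁻¹) + ∫ ζ, w ζ * (‖z - ζ‖ ^ 2)⁻¹) := by
  have hI := fun y => (integrable_mul_inv_sq hμ hw0 hwB hw y).1
  have hN : ∀ y, Integrable fun ζ => w ζ / ‖y - ζ‖ := by
    intro y
    refine (hw.add (hI y)).mono' ?_ (Filter.Eventually.of_forall fun ζ => ?_)
    · simp only [div_eq_mul_inv]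
      exact hw.aestronglyMeasurable.mul (by fun_prop : Measurable _).aestronglyMeasurable
    · rw [Real.norm_of_nonneg (div_nonneg (hw0 ζ) (norm_nonneg _))]
      have h1 : ‖y - ζ‖⁻¹ ≤ 1 + (‖y - ζ‖ ^ 2)⁻¹ := by
        rw [← inv_pow]
        nlinarith [sq_nonneg (‖y - ζ‖⁻¹ - 1)]
      calc w ζ / ‖y - ζ‖ = w ζ * ‖y - ζ‖⁻¹ := div_eq_mul_inv _ _
        _ ≤ w ζ * (1 + (‖y - ζ‖ ^ 2)⁻¹) := mul_le_mul_of_nonneg_left h1 (hw0 ζ)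
        _ = _ := by simp [mul_add]
  refine (abs_integral_sub_integral_le (hN x) (hN z)
    (((hI x).add (hI z)).const_mul ‖x - z‖) fun ζ => ?_).trans_eq ?_
  · have h1 := abs_inv_norm_sub_inv_norm_le (x - ζ) (z - ζ)
    rw [sub_sub_sub_cancel_right] at h1
    rw [div_eq_mul_inv, div_eq_mul_inv, ← mul_sub, abs_mul, abs_of_nonneg (hw0 ζ)]
    refine (mul_le_mul_of_nonneg_left h1 (hw0 ζ)).trans_eq ?_
    simp only [Pi.add_apply]
    ring
  · simp only [Pi.add_apply]
    rw [integral_const_mul, integral_add (hI x) (hI z)]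

/-- Increment bound for the potential of the image charges. -/
lemma abs_image_sub_le {w : EuclideanSpace ℝ (Fin 3) → ℝ} {μ ε : ℝ} (hμ : 0 < μ)
    (hε : 2 * μ < ε) (hw0 : ∀ z, 0 ≤ w z) (hws : ∀ z, μ < ‖z‖ → w z = 0) (hw : Integrable w)
    {x z : EuclideanSpace ℝ (Fin 3)} (hx : ‖x‖ < ε) (hz : ‖z‖ < ε) :
    |(∫ ζ, (ε / ‖ζ‖) * w ζ / ‖(ε ^ 2 / ‖ζ‖ ^ 2) • ζ - x‖) -
        ∫ ζ, (ε / ‖ζ‖) * w ζ / ‖(ε ^ 2 / ‖ζ‖ ^ 2) • ζ - z‖| ≤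
      ‖x - z‖ * (4 * (∫ ζ, w ζ) * (ε ^ 2)⁻¹) := by
  have hε0 : 0 < ε := by linarith
  have hfar : ∀ y ζ : EuclideanSpace ℝ (Fin 3), ‖y‖ < ε → ζ ≠ 0 → ‖ζ‖ ≤ μ →
      ‖(ε ^ 2 / ‖ζ‖ ^ 2) • ζ - y‖⁻¹ ≤ 2 * ‖ζ‖ / ε ^ 2 := by
    intro y ζ hy hζ0 hζ
    have hζp : 0 < ‖ζ‖ := norm_pos_iff.mpr hζ0
    have h1 : ‖(ε ^ 2 / ‖ζ‖ ^ 2) • ζ‖ = ε ^ 2 / ‖ζ‖ := by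
      rw [norm_smul, Real.norm_of_nonneg (by positivity)]
      field_simp
    have h2 := norm_sub_norm_le ((ε ^ 2 / ‖ζ‖ ^ 2) • ζ) y
    rw [h1] at h2
    have h3 : 2 * ε ≤ ε ^ 2 / ‖ζ‖ := by
      rw [le_div_iff₀ hζp]
      nlinarith
    have h4 : ε ^ 2 / ‖ζ‖ / 2 ≤ ‖(ε ^ 2 / ‖ζ‖ ^ 2) • ζ - y‖ := by linarith
    have h5 : 2 * ‖ζ‖ / ε ^ 2 = (ε ^ 2 / ‖ζ‖ / 2)⁻¹ := by field_simp
    rw [h5]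
    gcongr
  have hI : ∀ y : EuclideanSpace ℝ (Fin 3), ‖y‖ < ε →
      Integrable fun ζ => (ε / ‖ζ‖) * w ζ / ‖(ε ^ 2 / ‖ζ‖ ^ 2) • ζ - y‖ := by
    intro y hy
    refine (hw.mul_const (2 / ε)).mono' ?_ (Filter.Eventually.of_forall fun ζ => ?_)
    · simp only [div_eq_mul_inv]
      exact ((by fun_prop : Measurable _).aestronglyMeasurable.mul hw.aestronglyMeasurable).mul
        (by fun_prop : Measurable _).aestronglyMeasurable
    · have hwζ := hw0 ζ
      rw [Real.norm_of_nonneg (by positivity)]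
      rcases eq_or_ne ζ 0 with rfl | hζ0
      · simp only [norm_zero, div_zero, zero_mul, zero_div]
        positivity
      rcases lt_or_ge μ ‖ζ‖ with hζ | hζ
      · simp [hws ζ hζ]
      have hζp : 0 < ‖ζ‖ := norm_pos_iff.mpr hζ0
      rw [div_eq_mul_inv _ ‖_ - _‖]
      refine (mul_le_mul_of_nonneg_left (hfar y ζ hy hζ0 hζ) (by positivity)).trans_eq ?_
      field_simp
  refine (abs_integral_sub_integral_le (hI x hx) (hI z hz)
    (hw.mul_const (‖x - z‖ * (4 * (ε ^ 2)⁻¹))) fun ζ => ?_).trans_eq ?_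
  · have hwζ := hw0 ζ
    rcases eq_or_ne ζ 0 with rfl | hζ0
    · simp only [norm_zero, div_zero, zero_mul, zero_div, sub_self, abs_zero]
      positivity
    rcases lt_or_ge μ ‖ζ‖ with hζ | hζ
    · simp [hws ζ hζ]
    have hζp : 0 < ‖ζ‖ := norm_pos_iff.mpr hζ0
    set p := (ε ^ 2 / ‖ζ‖ ^ 2) • ζ with hp
    have h1 := abs_inv_norm_sub_inv_norm_le (p - x) (p - z)
    rw [sub_sub_sub_cancel_left, norm_sub_rev z x] at h1
    have hsq : ∀ y : EuclideanSpace ℝ (Fin 3), ‖y‖ < ε →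
        (‖p - y‖ ^ 2)⁻¹ ≤ (2 * ‖ζ‖ / ε ^ 2) ^ 2 := by
      intro y hy
      rw [← inv_pow]
      exact pow_le_pow_left₀ (by positivity) (hfar y ζ hy hζ0 hζ) 2
    rw [div_eq_mul_inv _ ‖p - x‖, div_eq_mul_inv _ ‖p - z‖, ← mul_sub, abs_mul,
      abs_of_nonneg (by positivity : 0 ≤ ε / ‖ζ‖ * w ζ)]
    calc ε / ‖ζ‖ * w ζ * |‖p - x‖⁻¹ - ‖p - z‖⁻¹|
        ≤ ε / ‖ζ‖ * w ζ * (‖x - z‖ * ((2 * ‖ζ‖ / ε ^ 2) ^ 2 + (2 * ‖ζ‖ / ε ^ 2) ^ 2)) := by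
          refine mul_le_mul_of_nonneg_left (h1.trans ?_) (by positivity)
          exact mul_le_mul_of_nonneg_left (add_le_add (hsq x hx) (hsq z hz)) (norm_nonneg _)
      _ = w ζ * (‖x - z‖ * (4 * (ε ^ 2)⁻¹)) * (2 * ‖ζ‖ / ε) := by
          field_simp
          ring
      _ ≤ w ζ * (‖x - z‖ * (4 * (ε ^ 2)⁻¹)) * 1 := by
          refine mul_le_mul_of_nonneg_left ?_ (by positivity)
          rw [div_le_one hε0]
          linarith
      _ = _ := mul_one _
  · rw [integral_mul_const]
    ring

theorem stmt17 (C₁ C₂ : ℝ) (hC₁ : 0 < C₁) (hC₂ : 0 < C₂) :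
    ∃ C : ℝ, 0 < C ∧
      ∀ (μ ε A : ℝ) (w h : EuclideanSpace ℝ (Fin 3) → ℝ),
        0 < μ → μ < ε → 2 < ε / μ → 0 < A →
        (∀ z, 0 ≤ w z) →
        (∀ z z' : EuclideanSpace ℝ (Fin 3), ‖z‖ = ‖z'‖ → w z = w z') →
        (∀ z : EuclideanSpace ℝ (Fin 3), μ < ‖z‖ → w z = 0) →
        (∀ z, w z ≤ C₁ * (∫ ζ : EuclideanSpace ℝ (Fin 3), w ζ) / μ ^ 3) →
        (∫ ζ : EuclideanSpace ℝ (Fin 3), w ζ) ≤ C₂ * A →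
        (∀ z : EuclideanSpace ℝ (Fin 3), h z =
          if ‖z‖ < ε then
            (1 / (4 * Real.pi)) *
              ((∫ ζ : EuclideanSpace ℝ (Fin 3), w ζ / ‖z - ζ‖) -
                ∫ ζ : EuclideanSpace ℝ (Fin 3),
                  (ε / ‖ζ‖) * w ζ / ‖(ε ^ 2 / ‖ζ‖ ^ 2) • ζ - z‖)
          else 0) →
        (∀ z, ‖fderiv ℝ h z‖ ≤ C * A / μ ^ 2) ∧
          Real.sqrt (∫ z : EuclideanSpace ℝ (Fin 3), ‖fderiv ℝ h z‖ ^ 2) ≤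
            C * A / Real.sqrt μ := by
  set J := ∫ y : EuclideanSpace ℝ (Fin 3), truncInvSq ‖y‖ with hJ
  set I := ∫ z : EuclideanSpace ℝ (Fin 3), ((1 + ‖z‖) ^ 4)⁻¹ with hI
  have hJ0 : 0 ≤ J := integral_nonneg fun y => truncInvSq_nonneg _
  have hI0 : 0 ≤ I := integral_nonneg fun y => by positivity
  set K := 9 * (1 + C₁ * J) with hK
  have hK0 : 0 < K := by positivity
  set D := (5 * K + 16) * C₂ with hD
  have hD0 : 0 < D := by positivity
  refine ⟨D * (1 + √I), by positivity, ?_⟩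
  intro μ ε A w h hμ _ hεμ hA hw0 _ hws hwB hwA hh
  have hε : 2 * μ < ε := (lt_div_iff₀ hμ).mp hεμ
  have hε0 : 0 < ε := by linarith
  have hw : Integrable w := by
    by_contra hni
    have h0 : w = 0 := by
      ext z
      have h1 := hwB z
      rw [integral_undef hni] at h1
      exact le_antisymm (by simpa using h1) (hw0 z)
    exact hni (h0 ▸ integrable_zero _ _ _)
  have hN := integral_mul_inv_sq_le hμ hC₁ hw0 hws hwB hw
  rw [← hJ, ← hK] at hN
  have hNL := abs_newton_sub_le hμ hw0 hwB hw
  have hPL := @abs_image_sub_le w μ ε hμ hε hw0 hws hw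
  set M := ∫ ζ, w ζ with hM
  have hM0 : 0 ≤ M := integral_nonneg hw0
  have main : ∀ z, ‖fderiv ℝ h z‖ ≤ D * A * ((μ + ‖z‖) ^ 2)⁻¹ := by
    intro z
    have hz0 := norm_nonneg z
    rcases le_or_gt ε ‖z‖ with hz | hz
    · rw [fderiv_eq_zero_of_ball_le_norm (ε := ε) (fun y hy => ?_) hz]
      · simp only [norm_zero]
        positivity
      · rw [hh, if_neg (not_lt.mpr hy)]
    have hMD : (5 * K + 16) * M * ((μ + ‖z‖) ^ 2)⁻¹ ≤ D * A * ((μ + ‖z‖) ^ 2)⁻¹ := by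
      rw [hD, mul_assoc (5 * K + 16) C₂ A]
      gcongr
    refine le_trans (norm_fderiv_le_of_lip' ℝ (by positivity) ?_) hMD
    have hc : Filter.Tendsto (fun x : EuclideanSpace ℝ (Fin 3) => ‖x‖) (nhds z) (nhds ‖z‖) :=
      continuous_norm.tendsto z
    filter_upwards [hc.eventually (gt_mem_nhds hz),
      hc.eventually (lt_mem_nhds (show (‖z‖ - μ) / 2 < ‖z‖ by linarith))] with x hx hx2
    have hx0 := norm_nonneg x
    rw [hh x, hh z, if_pos hx, if_pos hz, ← mul_sub, norm_mul]
    have h1 : ((μ + ‖x‖) ^ 2)⁻¹ ≤ 4 * ((μ + ‖z‖) ^ 2)⁻¹ := by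
      rw [← div_eq_mul_inv, le_div_iff₀ (by positivity), inv_mul_le_iff₀ (by positivity)]
      nlinarith
    have h2 : (ε ^ 2)⁻¹ ≤ 4 * ((μ + ‖z‖) ^ 2)⁻¹ := by
      rw [← div_eq_mul_inv, le_div_iff₀ (by positivity), inv_mul_le_iff₀ (by positivity)]
      nlinarith
    have h3 := hNL x z
    have h4 := hPL hx hz
    have h5 : (∫ ζ, w ζ * (‖x - ζ‖ ^ 2)⁻¹) + ∫ ζ, w ζ * (‖z - ζ‖ ^ 2)⁻¹ ≤
        5 * K * M * ((μ + ‖z‖) ^ 2)⁻¹ := by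
      have := mul_le_mul_of_nonneg_left h1 (by positivity : 0 ≤ K * M)
      linarith [hN x, hN z]
    have h6 : 4 * M * (ε ^ 2)⁻¹ ≤ 16 * M * ((μ + ‖z‖) ^ 2)⁻¹ := by
      have := mul_le_mul_of_nonneg_left h2 (by positivity : 0 ≤ 4 * M)
      linarith
    have h7 := mul_le_mul_of_nonneg_left (add_le_add h5 h6) (norm_nonneg (x - z))
    have h8 : ‖1 / (4 * Real.pi)‖ ≤ 1 := by
      rw [Real.norm_of_nonneg (by positivity), div_le_one (by positivity)]
      linarith [Real.pi_gt_three]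
    refine (mul_le_mul_of_nonneg_right h8 (norm_nonneg _)).trans ?_
    rw [one_mul, Real.norm_eq_abs, sub_sub_sub_comm]
    refine (abs_sub _ _).trans ?_
    linarith
  constructor
  · intro z
    refine (main z).trans ?_
    have h1 : ((μ + ‖z‖) ^ 2)⁻¹ ≤ (μ ^ 2)⁻¹ := by
      have := norm_nonneg z
      gcongr
      linarith
    calc D * A * ((μ + ‖z‖) ^ 2)⁻¹ ≤ D * A * (μ ^ 2)⁻¹ := by gcongr
      _ ≤ D * (1 + √I) * A * (μ ^ 2)⁻¹ := by
        have : D * 1 ≤ D * (1 + √I) := by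
          gcongr
          linarith [Real.sqrt_nonneg I]
        rw [mul_one] at this
        gcongr
      _ = _ := (div_eq_mul_inv _ _).symm
  · obtain ⟨hi, hv⟩ := add_norm_sq_integral hμ
    have h1 : (∫ z : EuclideanSpace ℝ (Fin 3), ‖fderiv ℝ h z‖ ^ 2) ≤
        (D * A) ^ 2 * (μ⁻¹ * I) := by
      rw [← hv, ← integral_const_mul]
      refine integral_mono_of_nonneg (Filter.Eventually.of_forall fun z => by positivity)
        (hi.const_mul _) (Filter.Eventually.of_forall fun z => ?_)
      refine (pow_le_pow_left₀ (norm_nonneg _) (main z) 2).trans_eq ?_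
      simp only [mul_pow, inv_pow]
      rw [← pow_mul]
    calc √(∫ z : EuclideanSpace ℝ (Fin 3), ‖fderiv ℝ h z‖ ^ 2)
        ≤ √((D * A) ^ 2 * (μ⁻¹ * I)) := Real.sqrt_le_sqrt h1
      _ = D * √I * A / √μ := by
        rw [Real.sqrt_mul (by positivity), Real.sqrt_sq (by positivity),
          Real.sqrt_mul (by positivity), Real.sqrt_inv]
        ring
      _ ≤ _ := by
        gcongr
        linarith
end
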